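/- Let A₁ and A₂ be commutative rings with identity 1 ≠ 0, neither of which is a field, and let P be a nonzero proper ideal of the product ring A = A₁ × A₂. Then P is a weakly 1-absorbing prime ideal of A if and only if P is a prime ideal of A, if and only if P = P₁ × A₂ for some prime ideal P₁ of A₁ or P = A₁ × P₂ for some prime ideal P₂ of A₂. -/

import Mathlib

/-- A proper ideal `P` is weakly 1-absorbing prime if whenever `0 ≠ x*y*z ∈ P` for
nonunits `x, y, z`, then `x*y ∈ P` or `z ∈ P`. -/
def IsWeakly1AbsorbingPrime {A : Type*} [CommRing A] (P : Ideal A) : Prop :=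
  P ≠ ⊤ ∧ ∀ x y z : A, ¬IsUnit x → ¬IsUnit y → ¬IsUnit z →
    x * y * z ≠ 0 → x * y * z ∈ P → x * y ∈ P ∨ z ∈ P

/-- A proper ideal `P` is weakly prime if whenever `0 ≠ x*y ∈ P`, then `x ∈ P` or `y ∈ P`. -/
def IsWeaklyPrime {A : Type*} [CommRing A] (P : Ideal A) : Prop :=
  P ≠ ⊤ ∧ ∀ x y : A, x * y ≠ 0 → x * y ∈ P → x ∈ P ∨ y ∈ P

theorem Ideal.IsPrime.isWeakly1AbsorbingPrime {A : Type*} [CommRing A] {P : Ideal A}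
    (hP : P.IsPrime) : IsWeakly1AbsorbingPrime P :=
  ⟨hP.ne_top, fun _ _ _ _ _ _ _ h => hP.mem_or_mem h⟩

namespace IsWeakly1AbsorbingPrime

variable {R S : Type*} [CommRing R] [CommRing S] {I : Ideal R} {J : Ideal S}

theorem prod_swap (h : IsWeakly1AbsorbingPrime (I.prod J)) :
    IsWeakly1AbsorbingPrime (J.prod I) := by
  refine ⟨fun htop => h.1 ?_, fun x y z hx hy hz h0 hmem => ?_⟩
  · rw [Ideal.prod_eq_top_iff] at htop ⊢
    exact htop.symm
  · have hunit (u : S × R) : IsUnit u.swap ↔ IsUnit u := by simp [Prod.isUnit_iff, and_comm]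
    have hswap : x.swap * y.swap * z.swap = (x * y * z).swap := rfl
    refine (h.2 x.swap y.swap z.swap ((hunit x).not.2 hx) ((hunit y).not.2 hy)
      ((hunit z).not.2 hz) ?_ ?_).imp And.symm And.symm
    · rw [hswap]
      exact fun h' => h0 (Prod.swap_injective h')
    · rw [hswap]
      exact And.symm hmem

theorem eq_top_or_eq_top_of_left_ne_bot (h : IsWeakly1AbsorbingPrime (I.prod J)) (hI : I ≠ ⊥) :
    I = ⊤ ∨ J = ⊤ := by
  rcases subsingleton_or_nontrivial S with hS | hS
  · exact Or.inr (Subsingleton.elim _ _)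
  obtain ⟨a, ha, ha0⟩ := Submodule.exists_mem_ne_zero_of_ne_bot hI
  by_cases hu : IsUnit a
  · exact Or.inl (I.eq_top_of_isUnit_mem ha hu)
  have := h.2 (1, 0) (1, 0) (a, 1) (by simp [Prod.isUnit_iff]) (by simp [Prod.isUnit_iff])
    (by simp [Prod.isUnit_iff, hu]) (by simp [ha0]) (by simp [Ideal.mem_prod, ha])
  simpa [Ideal.mem_prod, ha, ← Ideal.eq_top_iff_one] using this

theorem eq_top_or_eq_top (h : IsWeakly1AbsorbingPrime (I.prod J)) (hne : I.prod J ≠ ⊥) :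
    I = ⊤ ∨ J = ⊤ := by
  by_cases hI : I = ⊥
  · have hJ : J ≠ ⊥ := fun hJ => hne (by rw [hI, hJ, Ideal.prod_bot_bot])
    exact (h.prod_swap.eq_top_or_eq_top_of_left_ne_bot hJ).symm
  · exact h.eq_top_or_eq_top_of_left_ne_bot hI

theorem isPrime_of_top_prod [Nontrivial R] (hR : ¬IsField R)
    (h : IsWeakly1AbsorbingPrime (Ideal.prod (⊤ : Ideal R) J)) : J.IsPrime := by
  obtain ⟨w, hw0, hw⟩ := Ring.exists_not_isUnit_of_not_isField hR
  refine ⟨fun hJ => h.1 (by rw [hJ, Ideal.prod_top_top]), fun {c d} hcd => ?_⟩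
  by_cases hc : IsUnit c
  · exact Or.inr ((J.unit_mul_mem_iff_mem hc).1 hcd)
  by_cases hd : IsUnit d
  · exact Or.inl ((J.mul_unit_mem_iff_mem hd).1 hcd)
  have := h.2 (1, c) (w, 1) (1, d) (by simp [Prod.isUnit_iff, hc])
    (by simp [Prod.isUnit_iff, hw]) (by simp [Prod.isUnit_iff, hd]) (by simp [hw0])
    (by simpa [Ideal.mem_prod] using hcd)
  simpa [Ideal.mem_prod] using this

end IsWeakly1AbsorbingPrime

theorem prod_isWeakly1AbsorbingPrime_iff {A₁ A₂ : Type*} [CommRing A₁] [CommRing A₂]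
    [Nontrivial A₁] [Nontrivial A₂] (h₁ : ¬IsField A₁) (h₂ : ¬IsField A₂)
    (P : Ideal (A₁ × A₂)) (hne : P ≠ ⊥) (hpr : P ≠ ⊤) :
    (IsWeakly1AbsorbingPrime P ↔ P.IsPrime) ∧
    (P.IsPrime ↔
      ((∃ P₁ : Ideal A₁, P₁.IsPrime ∧ P = P₁.prod ⊤) ∨
       (∃ P₂ : Ideal A₂, P₂.IsPrime ∧ P = Ideal.prod ⊤ P₂))) := by
  refine ⟨⟨fun h => ?_, Ideal.IsPrime.isWeakly1AbsorbingPrime⟩, Ideal.ideal_prod_prime P⟩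
  obtain ⟨I, J, rfl⟩ : ∃ (I : Ideal A₁) (J : Ideal A₂), P = I.prod J :=
    ⟨_, _, Ideal.ideal_prod_eq P⟩
  rcases h.eq_top_or_eq_top hne with rfl | rfl
  · have := h.isPrime_of_top_prod h₁
    exact Ideal.isPrime_ideal_prod_top'
  · have := h.prod_swap.isPrime_of_top_prod h₂
    exact Ideal.isPrime_ideal_prod_top
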